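/- Either the size of the palette increases or the two last colorings are isomorphic: for every n, if K_n = K_{n+1}, then the relations C_n and C_{n+1} coincide, i.e., for all vertices v, w, v is C_n-related to w if and only if v is C_{n+1}-related to w. (Lemma 3.) -/

import Mathlib

/-- Iterated color-refinement relation: `colRel V G 0` relates all pairs;
`colRel V G (n+1)` relates `v` and `w` iff for every vertex `u`, the number of
neighbors of `v` that are `colRel V G n`-related to `u` equals the number of
neighbors of `w` that are `colRel V G n`-related to `u`. -/
def colRel (V : Type*) (G : SimpleGraph V) : ℕ → V → V → Prop
  | 0 => fun _ _ => True
  | n + 1 => fun v w => ∀ u : V,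
      {x | G.Adj v x ∧ colRel V G n x u}.ncard =
      {x | G.Adj w x ∧ colRel V G n x u}.ncard

/-- `numClasses V G n` is the number of `colRel V G n`-equivalence classes. -/
noncomputable def numClasses (V : Type*) (G : SimpleGraph V) (n : ℕ) : ℕ :=
  {s : Set V | ∃ v : V, s = {w | colRel V G n v w}}.ncard

theorem colRel_equivalence (V : Type*) (G : SimpleGraph V) (n : ℕ) :
    Equivalence (colRel V G n) := by
  cases n with
  | zero => exact ⟨fun _ => trivial, fun _ => trivial, fun _ _ => trivial⟩
  | succ n =>
    exact ⟨fun _ _ => rfl, fun h u => (h u).symm, fun h k u => (h u).trans (k u)⟩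

theorem ncard_coarse {V : Type*} [Fintype V] (r s : V → V → Prop) (hr : Equivalence r)
    (hs : Equivalence s) (hrs : ∀ x y, r x y → s x y) (A B : V → Prop)
    (h : ∀ u, {x | A x ∧ r x u}.ncard = {x | B x ∧ r x u}.ncard) (u : V) :
    {x | A x ∧ s x u}.ncard = {x | B x ∧ s x u}.ncard := by
  classical
  let R : Setoid V := ⟨r, hr⟩
  have key : ∀ A : V → Prop, {x | A x ∧ s x u}.ncard =
      ∑ q : Quotient R, if s q.out u then {x | A x ∧ r x q.out}.ncard else 0 := by
    intro A
    have e : {x | A x ∧ s x u} = ((Finset.univ.filter fun x => A x ∧ s x u : Finset V) : Set V) := by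
      ext; simp
    rw [e, Set.ncard_coe_finset, Finset.card_eq_sum_card_fiberwise
      (f := fun x => (Quotient.mk R x)) (t := Finset.univ) (by intro x _; simp)]
    refine Finset.sum_congr rfl fun q _ => ?_
    have hq : ∀ x, Quotient.mk R x = q ↔ r x q.out := by
      intro x
      constructor
      · intro hx
        exact Quotient.exact (s := R) (hx.trans (Quotient.out_eq q).symm)
      · intro hx
        exact (Quotient.sound (s := R) hx).trans (Quotient.out_eq q)
    split_ifs with hu
    · rw [← Set.ncard_coe_finset]
      congr 1
      ext x
      simp only [Finset.coe_filter, Finset.mem_filter, Finset.mem_univ, true_and,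
        Set.mem_setOf_eq, hq]
      exact ⟨fun k => ⟨k.1.1, k.2⟩, fun k => ⟨⟨k.1, hs.trans (hrs _ _ k.2) hu⟩, k.2⟩⟩
    · rw [Finset.card_eq_zero, Finset.filter_eq_empty_iff]
      intro x hx hxq
      simp only [Finset.mem_filter, Finset.mem_univ, true_and] at hx
      exact hu (hs.trans (hs.symm (hrs _ _ ((hq x).1 hxq))) hx.2)
  rw [key A, key B]
  simp only [h]

theorem colRel_succ_le (V : Type*) [Fintype V] (G : SimpleGraph V) (n : ℕ) :
    ∀ v w : V, colRel V G (n + 1) v w → colRel V G n v w := by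
  induction n with
  | zero => intro _ _ _; trivial
  | succ n ih =>
    intro v w h u
    exact ncard_coarse _ _ (colRel_equivalence V G (n + 1)) (colRel_equivalence V G n) ih
      (G.Adj v) (G.Adj w) h u

/-- Lemma 3: if the palette size does not increase, the two last colorings coincide. -/
theorem colRel_eq_of_numClasses_eq (V : Type*) [Fintype V] (G : SimpleGraph V) (n : ℕ)
    (h : numClasses V G n = numClasses V G (n + 1)) :
    ∀ v w : V, colRel V G n v w ↔ colRel V G (n + 1) v w := by
  have en := colRel_equivalence V G n
  have em := colRel_equivalence V G (n + 1)
  have hle := colRel_succ_le V G n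
  let g : Set V → Set V := fun s => {w | ∃ x ∈ s, colRel V G n x w}
  have hg : ∀ v, g {w | colRel V G (n + 1) v w} = {w | colRel V G n v w} := by
    intro v
    ext w
    exact ⟨fun ⟨x, hx, hxw⟩ => en.trans (hle _ _ hx) hxw, fun hw => ⟨v, em.refl v, hw⟩⟩
  have himg : g '' {s : Set V | ∃ v : V, s = {w | colRel V G (n + 1) v w}} =
      {s : Set V | ∃ v : V, s = {w | colRel V G n v w}} := by
    ext s
    constructor
    · rintro ⟨_, ⟨v, rfl⟩, rfl⟩
      exact ⟨v, hg v⟩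
    · rintro ⟨v, rfl⟩
      exact ⟨_, ⟨v, rfl⟩, hg v⟩
  have hinj := Set.injOn_of_ncard_image_eq (f := g)
    (s := {s : Set V | ∃ v : V, s = {w | colRel V G (n + 1) v w}})
    (by rw [himg]; exact h) (Set.toFinite _)
  intro v w
  refine ⟨fun hvw => ?_, hle v w⟩
  have heq : {x | colRel V G (n + 1) v x} = {x | colRel V G (n + 1) w x} := by
    refine hinj ⟨v, rfl⟩ ⟨w, rfl⟩ ?_
    rw [hg, hg]
    ext x
    exact ⟨fun k => en.trans (en.symm hvw) k, fun k => en.trans hvw k⟩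
  have hw : w ∈ {x | colRel V G (n + 1) w x} := em.refl w
  rw [← heq] at hw
  exact hw
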